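/- arXiv:1808.02974 — 2 statements merged into one kernel-verified Lean document; each statement's English description precedes it below -/
import Mathlib

section
/- For every δ ∈ (0,1] there exist constants c₁, c₂ > 0 and n₀ ∈ ℕ such that for every n ≥ n₀ there exist m ≥ c₁·n, a function AExt: 𝔽₂^n → 𝔽₂^m that is a (δn, ε)-almost perfect affine extractor with ε ≤ 2^{−c₂·n}, and a randomized map Inv: 𝔽₂^m × R → 𝔽₂^n (R a finite set of coins, sampled uniformly) satisfying: AExt(Inv(s,r)) = s for every s ∈ 𝔽₂^m and every r ∈ R, and Inv(U_m, U_R) is ε-close in statistical distance to the uniform distribution on 𝔽₂^n. -/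
/-- The probability, over a uniformly random sample `ω : Ω`, that `X ω = a`. -/
noncomputable def prob {Ω α : Type*} (X : Ω → α) (a : α) : ℝ :=
  (Nat.card {ω : Ω // X ω = a} : ℝ) / (Nat.card Ω : ℝ)

/-- Statistical distance between the distributions of `X` and `Y` (coins uniform). -/
noncomputable def SD {Ω₁ Ω₂ α : Type*} [Fintype α] (X : Ω₁ → α) (Y : Ω₂ → α) : ℝ :=
  (1 / 2 : ℝ) * ∑ a : α, |prob X a - prob Y a|

/-- `AExt` is a `(k,ε)`-almost perfect affine extractor (real entropy threshold `k`):
for every affine source uniform on a coset `v₀ + V` with `dim V ≥ k` and every `y`,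
`|Pr[AExt(X) = y] - 2⁻ᵐ| ≤ 2⁻ᵐ · ε`. -/
def IsAlmostPerfectAffineExtractor {n m : ℕ}
    (AExt : (Fin n → ZMod 2) → Fin m → ZMod 2) (k : ℝ) (ε : ℝ) : Prop :=
  ∀ (V : Submodule (ZMod 2) (Fin n → ZMod 2)) (v₀ : Fin n → ZMod 2),
    k ≤ (Module.finrank (ZMod 2) V : ℝ) →
    ∀ y : Fin m → ZMod 2,
      |prob (fun x : V => AExt (v₀ + (x : Fin n → ZMod 2))) y - ((2 : ℝ) ^ m)⁻¹| ≤
        ((2 : ℝ) ^ m)⁻¹ * ε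

section

open Finset

/-- Moment generating function bound for a uniformly random function `f : α → β`: the sum over `S`
of a bounded centred statistic of the values of `f` is sub-Gaussian. -/
lemma sum_exp_mul_sum_le {α β : Type*} [Fintype α] [DecidableEq α] [Fintype β] (S : Finset α)
    (g : β → ℝ) (c : ℝ) (hg : ∀ b, |c * g b| ≤ |c|) (hc : |c| ≤ 1) (h0 : ∑ b, g b = 0) :
    ∑ f : α → β, Real.exp (c * ∑ x ∈ S, g (f x)) ≤
      (Fintype.card β : ℝ) ^ Fintype.card α * Real.exp (c ^ 2 * #S) := by
  have hfactor : ∑ b, Real.exp (c * g b) ≤ Fintype.card β * Real.exp (c ^ 2) := by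
    have hle : ∀ b, Real.exp (c * g b) ≤ 1 + c * g b + c ^ 2 := fun b => by
      have h1 := (abs_le.1 (Real.abs_exp_sub_one_sub_id_le ((hg b).trans hc))).2
      have h2 := sq_le_sq.2 (hg b)
      linarith
    calc ∑ b, Real.exp (c * g b) ≤ ∑ b, (1 + c * g b + c ^ 2) := sum_le_sum fun b _ => hle b
      _ = Fintype.card β * (c ^ 2 + 1) := by
        simp only [sum_add_distrib, ← mul_sum, h0, sum_const, card_univ, nsmul_eq_mul]
        ring
      _ ≤ _ := by gcongr; exact Real.add_one_le_exp _
  calc ∑ f : α → β, Real.exp (c * ∑ x ∈ S, g (f x))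
      = ∑ f : α → β, ∏ x, (if x ∈ S then Real.exp (c * g (f x)) else 1) := by
        refine sum_congr rfl fun f _ => ?_
        rw [mul_sum, Real.exp_sum, prod_ite_mem, univ_inter]
    _ = ∏ x : α, ∑ b, (if x ∈ S then Real.exp (c * g b) else 1) := by
        rw [prod_univ_sum, Fintype.piFinset_univ]
    _ ≤ ∏ x : α, (Fintype.card β * (if x ∈ S then Real.exp (c ^ 2) else 1)) := by
        refine prod_le_prod (fun x _ => sum_nonneg fun b _ => ?_) fun x _ => ?_
        · split_ifs <;> positivity
        · split_ifs
          · exact hfactor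
          · simp
    _ = _ := by
        rw [prod_mul_distrib, prod_const, card_univ, prod_ite_mem, univ_inter, prod_const,
          ← Real.exp_nat_mul, mul_comm (c ^ 2)]

/-- A union bound: some function equidistributes simultaneously on all sets of a family of large
sets that is not too numerous. -/
lemma exists_forall_abs_card_filter_sub_le {α β ι : Type*} [Fintype α] [DecidableEq α] [Fintype β]
    [DecidableEq β] [Nonempty β] [Fintype ι] (S : ι → Finset α) (N t : ℝ) (ht0 : 0 ≤ t)
    (ht1 : t ≤ 1) (hN : ∀ i, N ≤ #(S i))
    (hcard : 2 * Fintype.card ι * Fintype.card β * Real.exp (-(t ^ 2 * N / 4)) < 1) :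
    ∃ f : α → β, ∀ i y,
      |(#{x ∈ S i | f x = y} : ℝ) - #(S i) / Fintype.card β| ≤ t * #(S i) := by
  set B : ℝ := (Fintype.card β : ℝ) with hB
  have hB1 : 1 ≤ B := by rw [hB]; exact_mod_cast Fintype.card_pos (α := β)
  let g : β → β → ℝ := fun y b => (if b = y then 1 else 0) - 1 / B
  have hg1 : ∀ y b, |g y b| ≤ 1 := fun y b => by
    have h1 : 1 / B ≤ 1 := by rw [div_le_one (by linarith)]; exact hB1
    have h2 : 0 ≤ 1 / B := by positivity
    simp only [g]
    split_ifs <;> rw [abs_le] <;> constructor <;> linarith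
  have hg0 : ∀ y, ∑ b, g y b = 0 := fun y => by
    simp only [g, sum_sub_distrib, sum_ite_eq', mem_univ, if_true, sum_const, card_univ,
      nsmul_eq_mul, ← hB]
    field_simp
    ring
  have hgS : ∀ (f : α → β) i y,
      ∑ x ∈ S i, g y (f x) = (#{x ∈ S i | f x = y} : ℝ) - #(S i) / B := fun f i y => by
    simp only [g, sum_sub_distrib, sum_boole, sum_const, nsmul_eq_mul]
    ring
  let D : Bool → ℝ := fun σ => if σ then t / 2 else -(t / 2)
  have hD : ∀ σ, |D σ| = t / 2 := fun σ => by
    cases σ <;> simp [D, abs_of_nonneg ht0, abs_div]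
  have hDsq : ∀ σ, D σ ^ 2 = t ^ 2 / 4 := fun σ => by
    rw [← sq_abs, hD]; ring
  let W : (α → β) → (ι × β) × Bool → ℝ := fun f p =>
    Real.exp (D p.2 * ∑ x ∈ S p.1.1, g p.1.2 (f x)) * Real.exp (-(t ^ 2 / 2 * #(S p.1.1)))
  have hterm : ∀ p, ∑ f, W f p ≤ B ^ Fintype.card α * Real.exp (-(t ^ 2 * N / 4)) := fun p => by
    have h := sum_exp_mul_sum_le (S p.1.1) (g p.1.2) (D p.2)
      (fun b => by
        rw [abs_mul]; exact mul_le_of_le_one_right (abs_nonneg _) (hg1 _ _))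
      (by rw [hD]; linarith) (hg0 _)
    rw [← sum_mul]
    refine (mul_le_mul_of_nonneg_right h (Real.exp_pos _).le).trans ?_
    rw [mul_assoc, ← Real.exp_add, hDsq]
    gcongr
    nlinarith [hN p.1.1, sq_nonneg t]
  have htotal : ∑ f, ∑ p, W f p < ∑ _f : α → β, (1 : ℝ) := by
    rw [sum_comm]
    calc ∑ p, ∑ f, W f p
        ≤ ∑ _p : (ι × β) × Bool, B ^ Fintype.card α * Real.exp (-(t ^ 2 * N / 4)) :=
          sum_le_sum fun p _ => hterm p
      _ = B ^ Fintype.card α *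
          (2 * Fintype.card ι * B * Real.exp (-(t ^ 2 * N / 4))) := by
          simp only [sum_const, card_univ, Fintype.card_prod, Fintype.card_bool, nsmul_eq_mul]
          push_cast
          ring
      _ < B ^ Fintype.card α * 1 := by gcongr
      _ = _ := by simp [hB]
  obtain ⟨f, -, hf⟩ := exists_lt_of_sum_lt htotal
  refine ⟨f, fun i y => ?_⟩
  rcases ht0.eq_or_lt with rfl | htpos
  · exfalso
    have : 0 < Fintype.card ι := Fintype.card_pos_iff.2 ⟨i⟩
    have : (1 : ℝ) ≤ Fintype.card ι := by exact_mod_cast this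
    norm_num at hcard
    nlinarith
  have key : ∀ σ, D σ * ((#{x ∈ S i | f x = y} : ℝ) - #(S i) / B) ≤ t ^ 2 / 2 * #(S i) :=
    fun σ => by
      have h1 : W f ((i, y), σ) < 1 :=
        (single_le_sum (f := W f) (fun p _ => by positivity) (mem_univ _)).trans_lt hf
      simp only [W, hgS] at h1
      rw [← Real.exp_add, Real.exp_lt_one_iff] at h1
      linarith
  have h1 := key true
  have h2 := key false
  simp only [D, if_true, Bool.false_eq_true, if_false] at h1 h2
  rw [abs_le]
  constructor <;> nlinarith

lemma prob_id {α : Type*} (a : α) : prob (id : α → α) a = 1 / Nat.card α := by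
  simp [prob]

/-- The number of sections of a family is the size of one member times the number of sections
with a prescribed value there. -/
lemma natCard_pi_eq_mul {β : Type*} [DecidableEq β] (F : β → Type*) (b : β) (z : F b) :
    Nat.card (∀ s, F s) = Nat.card (F b) * Nat.card {r : ∀ s, F s // r b = z} := by
  let e := Equiv.piSplitAt b F
  rw [Nat.card_congr e, Nat.card_prod]
  congr 1
  refine Nat.card_congr ?_
  refine ⟨fun q => ⟨e.symm (z, q), ?_⟩, fun r => (e r.1).2, fun q => ?_, fun r => ?_⟩
  · exact congrArg Prod.fst (e.apply_symm_apply (z, q))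
  · exact congrArg Prod.snd (e.apply_symm_apply (z, q))
  · apply Subtype.ext
    apply e.injective
    rw [e.apply_symm_apply]
    exact Prod.ext r.2.symm rfl

/-- A nearly equidistributed map has a randomized inverse which sends the uniform distribution
nearly to the uniform distribution. -/
lemma exists_randomized_inverse {α β : Type} [Fintype α] [Fintype β] (A : α → β) (ε : ℝ)
    (hε0 : 0 ≤ ε) (hε1 : ε < 1)
    (hA : ∀ y, |prob A y - (Nat.card β : ℝ)⁻¹| ≤ (Nat.card β : ℝ)⁻¹ * ε) :
    ∃ (R : Type) (_ : Fintype R) (_ : Nonempty R) (Inv : β × R → α),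
      (∀ s r, A (Inv (s, r)) = s) ∧ SD Inv (id : α → α) ≤ ε := by
  classical
  have hfib : ∀ y, Nonempty {x // A x = y} := fun y => by
    by_contra h
    rw [not_nonempty_iff] at h
    have : Nonempty β := ⟨y⟩
    have hpos : (0 : ℝ) < (Nat.card β : ℝ)⁻¹ := by
      have := Nat.card_pos (α := β)
      positivity
    have := hA y
    rw [prob, Nat.card_of_isEmpty, Nat.cast_zero, zero_div, zero_sub, abs_neg,
      abs_of_pos hpos] at this
    nlinarith
  refine ⟨∀ s, {x // A x = s}, inferInstance, inferInstance, fun p => (p.2 p.1).1,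
    fun s r => (r s).2, ?_⟩
  have hprob : ∀ x, prob (fun p : β × (∀ s, {x // A x = s}) => (p.2 p.1).1) x =
      (Nat.card β : ℝ)⁻¹ * (Nat.card {x' // A x' = A x} : ℝ)⁻¹ := fun x => by
    have hc : Nat.card {p : β × (∀ s, {x // A x = s}) // (p.2 p.1).1 = x} =
        Nat.card {r : ∀ s, {x // A x = s} // r (A x) = ⟨x, rfl⟩} := by
      refine Nat.card_congr ⟨fun p => ⟨p.1.2, ?_⟩, fun r => ⟨(A x, r.1), ?_⟩, ?_, ?_⟩
      · obtain ⟨⟨s, r⟩, rfl⟩ := p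
        have hs : A (r s).1 = s := (r s).2
        apply Subtype.ext
        exact congrArg (fun u => (r u).1) hs
      · exact congrArg Subtype.val r.2
      · rintro ⟨⟨s, r⟩, rfl⟩
        have hs : A (r s).1 = s := (r s).2
        exact Subtype.ext (Prod.ext hs rfl)
      · intro r
        rfl
    have h2 := natCard_pi_eq_mul (fun s => {x // A x = s}) (A x) ⟨x, rfl⟩
    have hpos : 0 < Nat.card (∀ s, {x // A x = s}) := Nat.card_pos
    have hne : Nat.card {r : ∀ s, {x // A x = s} // r (A x) = ⟨x, rfl⟩} ≠ 0 := by
      intro h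
      rw [h, mul_zero] at h2
      omega
    rw [prob, hc, Nat.card_prod, h2]
    have hne' : (Nat.card {r : ∀ s, {x // A x = s} // r (A x) = ⟨x, rfl⟩} : ℝ) ≠ 0 := by
      exact_mod_cast hne
    push_cast
    rw [← mul_assoc, div_mul_cancel_right₀ hne', mul_inv]
  have hbound : ∀ x, |prob (fun p : β × (∀ s, {x // A x = s}) => (p.2 p.1).1) x -
      prob (id : α → α) x| ≤
        (Nat.card β : ℝ)⁻¹ * ε * (Nat.card {x' // A x' = A x} : ℝ)⁻¹ := fun x => by
    have : Nonempty α := ⟨x⟩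
    have hF : (0 : ℝ) < Nat.card {x' // A x' = A x} := by
      have := hfib (A x)
      exact_mod_cast Nat.card_pos
    rw [hprob, prob_id]
    have heq : (Nat.card β : ℝ)⁻¹ * (Nat.card {x' // A x' = A x} : ℝ)⁻¹ - 1 / Nat.card α =
        -((prob A (A x) - (Nat.card β : ℝ)⁻¹) * (Nat.card {x' // A x' = A x} : ℝ)⁻¹) := by
      rw [prob]
      field_simp
      ring
    rw [heq, abs_neg, abs_mul, abs_of_pos (inv_pos.2 hF)]
    gcongr
    exact hA _
  have hsum : ∑ x, (Nat.card β : ℝ)⁻¹ * ε * (Nat.card {x' // A x' = A x} : ℝ)⁻¹ ≤ ε := by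
    rw [← sum_fiberwise univ A]
    calc ∑ y, ∑ x with A x = y, (Nat.card β : ℝ)⁻¹ * ε * (Nat.card {x' // A x' = A x} : ℝ)⁻¹
        = ∑ y : β, (Nat.card β : ℝ)⁻¹ * ε := by
          refine sum_congr rfl fun y _ => ?_
          have hF : (0 : ℝ) < Nat.card {x' // A x' = y} := by
            have := hfib y
            exact_mod_cast Nat.card_pos
          rw [sum_congr rfl (g := fun _ => (Nat.card β : ℝ)⁻¹ * ε *
            (Nat.card {x' // A x' = y} : ℝ)⁻¹) fun x hx => by rw [(mem_filter.1 hx).2],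
            sum_const, nsmul_eq_mul, ← Fintype.card_subtype, ← Nat.card_eq_fintype_card]
          field_simp
      _ ≤ ε := by
          rw [sum_const, card_univ, nsmul_eq_mul, ← Nat.card_eq_fintype_card, ← mul_assoc]
          exact mul_le_of_le_one_left hε0 mul_inv_le_one
  have := (sum_le_sum fun x _ => hbound x).trans hsum
  rw [SD]
  linarith

/-- A union bound over all affine subspaces: a random function is an affine extractor. -/
lemma exists_isAlmostPerfectAffineExtractor (n m : ℕ) (k ε : ℝ) (hε0 : 0 ≤ ε) (hε1 : ε ≤ 1)
    (hcard : 2 * (2 : ℝ) ^ (n * n + n) * 2 ^ m *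
      Real.exp (-((((2 : ℝ) ^ m)⁻¹ * ε) ^ 2 * 2 ^ k / 4)) < 1) :
    ∃ A : (Fin n → ZMod 2) → Fin m → ZMod 2, IsAlmostPerfectAffineExtractor A k ε := by
  classical
  let ι := {p : Matrix (Fin n) (Fin n) (ZMod 2) × (Fin n → ZMod 2) //
    k ≤ (Module.finrank (ZMod 2) (LinearMap.range (Matrix.toLin' p.1)) : ℝ)}
  let S : ι → Finset (Fin n → ZMod 2) := fun p =>
    univ.map ((Function.Embedding.subtype (· ∈ LinearMap.range (Matrix.toLin' p.1.1))).trans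
      (addLeftEmbedding p.1.2))
  have hι : (Fintype.card ι : ℝ) ≤ 2 ^ (n * n + n) := by
    have h := Fintype.card_subtype_le (fun p : Matrix (Fin n) (Fin n) (ZMod 2) ×
      (Fin n → ZMod 2) =>
        k ≤ (Module.finrank (ZMod 2) (LinearMap.range (Matrix.toLin' p.1)) : ℝ))
    have h2 : Fintype.card (Matrix (Fin n) (Fin n) (ZMod 2) × (Fin n → ZMod 2)) =
        2 ^ (n * n + n) := by
      rw [Fintype.card_prod, ← Nat.card_eq_fintype_card (α := Matrix _ _ _)]
      simp [Matrix, Nat.card_eq_fintype_card, ZMod.card, pow_add, pow_mul]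
    rw [h2] at h
    exact_mod_cast h
  have hβ : (Fintype.card (Fin m → ZMod 2) : ℝ) = 2 ^ m := by simp [ZMod.card]
  have hS : ∀ i, (2 : ℝ) ^ k ≤ #(S i) := fun i => by
    have hc : #(S i) = 2 ^ Module.finrank (ZMod 2) (LinearMap.range (Matrix.toLin' i.1.1)) := by
      rw [card_map, card_univ, Module.card_eq_pow_finrank (K := ZMod 2), ZMod.card]
    rw [hc, Nat.cast_pow, Nat.cast_ofNat, ← Real.rpow_natCast]
    exact Real.rpow_le_rpow_of_exponent_le one_le_two i.2
  have ht1 : ((2 : ℝ) ^ m)⁻¹ * ε ≤ 1 :=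
    mul_le_one₀ (inv_le_one_of_one_le₀ (one_le_pow₀ one_le_two)) hε0 hε1
  obtain ⟨A, hA⟩ := exists_forall_abs_card_filter_sub_le (β := Fin m → ZMod 2) S (2 ^ k)
    (((2 : ℝ) ^ m)⁻¹ * ε) (by positivity) ht1 hS (by
      rw [hβ]
      refine lt_of_le_of_lt ?_ hcard
      gcongr)
  refine ⟨A, fun V v₀ hV y => ?_⟩
  obtain ⟨p, hp⟩ := V.subtype.exists_leftInverse_of_injective V.ker_subtype
  have hrange : LinearMap.range (Matrix.toLin' (LinearMap.toMatrix' (V.subtype ∘ₗ p))) = V := by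
    rw [Matrix.toLin'_toMatrix', LinearMap.range_comp_of_range_eq_top, Submodule.range_subtype]
    exact LinearMap.range_eq_top.2 fun v => ⟨v, LinearMap.congr_fun hp v⟩
  have hi := hA ⟨(LinearMap.toMatrix' (V.subtype ∘ₗ p), v₀), by rw [hrange]; exact hV⟩ y
  have hSV : S ⟨(LinearMap.toMatrix' (V.subtype ∘ₗ p), v₀), by rw [hrange]; exact hV⟩ =
      univ.map ((Function.Embedding.subtype (· ∈ V)).trans (addLeftEmbedding v₀)) := by
    ext x
    simp only [S, mem_map, mem_univ, true_and, Function.Embedding.trans_apply,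
      Function.Embedding.subtype_apply, Subtype.exists, hrange]
  rw [hSV, filter_map, card_map, card_map, card_univ, hβ] at hi
  have hV0 : (0 : ℝ) < Fintype.card V := by exact_mod_cast Fintype.card_pos
  have hpr : prob (fun x : V => A (v₀ + (x : Fin n → ZMod 2))) y =
      (#{x : V | A (v₀ + (x : Fin n → ZMod 2)) = y} : ℝ) / Fintype.card V := by
    rw [prob, Nat.card_eq_fintype_card, Nat.card_eq_fintype_card, Fintype.card_subtype]
  rw [hpr, ← mul_le_mul_iff_left₀ hV0]
  refine le_trans (le_of_eq ?_) hi
  rw [← abs_of_pos hV0, ← abs_mul, abs_of_pos hV0, sub_mul, div_mul_cancel₀ _ hV0.ne']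
  congr 2
  ring

/-- The failure probability of the union bound over affine subspaces is eventually below one. -/
lemma exists_forall_union_bound_lt_one (δ : ℝ) (hδ0 : 0 < δ) (hδ1 : δ ≤ 1) :
    ∃ n₀ : ℕ, 0 < n₀ ∧ ∀ n : ℕ, n₀ ≤ n →
      2 * (2 : ℝ) ^ (n * n + n) * 2 ^ ⌈δ / 8 * n⌉₊ *
        Real.exp (-((((2 : ℝ) ^ ⌈δ / 8 * n⌉₊)⁻¹ * (2 : ℝ) ^ (-(δ / 8 * n))) ^ 2 *
          2 ^ (δ * n) / 4)) < 1 := by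
  set a : ℝ := Real.log 2 * δ / 2 with ha
  have ha0 : 0 < a := by
    have := Real.log_pos one_lt_two
    positivity
  refine ⟨⌈480 / a ^ 3⌉₊ + 1, Nat.succ_pos _, fun n hn => ?_⟩
  have hn1 : (1 : ℝ) ≤ n := by exact_mod_cast (Nat.le_add_left 1 _).trans hn
  have hna : 480 < a ^ 3 * n := by
    have h1 : 480 / a ^ 3 < n := (Nat.le_ceil _).trans_lt (by exact_mod_cast hn)
    rw [div_lt_iff₀ (by positivity)] at h1
    linarith
  set m := ⌈δ / 8 * n⌉₊ with hm
  have hm1 : (m : ℝ) < δ / 8 * n + 1 := Nat.ceil_lt_add_one (by positivity)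
  set E : ℝ := Real.exp (a * n / 4) with hE
  have hE0 : 0 < E := Real.exp_pos _
  have hε : (2 : ℝ) ^ (-(δ / 8 * n)) = E⁻¹ := by
    rw [Real.rpow_def_of_pos two_pos, hE, ← Real.exp_neg, ha]
    congr 1; ring
  have hN : (2 : ℝ) ^ (δ * n) = E ^ 8 := by
    rw [Real.rpow_def_of_pos two_pos, hE, ← Real.exp_nat_mul, ha]
    congr 1; push_cast; ring
  have h2m : (2 : ℝ) ^ m ≤ 2 * E := by
    calc (2 : ℝ) ^ m = (2 : ℝ) ^ (m : ℝ) := (Real.rpow_natCast _ _).symm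
      _ ≤ (2 : ℝ) ^ (1 + δ / 8 * n) :=
        Real.rpow_le_rpow_of_exponent_le one_le_two (by linarith)
      _ = 2 * E := by
        rw [Real.rpow_add two_pos, Real.rpow_one, ← inv_inv E, ← hε, Real.rpow_neg two_pos.le,
          inv_inv]
  have hexp : E ^ 4 / 16 ≤ (((2 : ℝ) ^ m)⁻¹ * E⁻¹) ^ 2 * E ^ 8 / 4 := by
    calc E ^ 4 / 16 = ((2 * E)⁻¹ * E⁻¹) ^ 2 * E ^ 8 / 4 := by field_simp; norm_num
      _ ≤ _ := by gcongr
  have hE4 : (a * n) ^ 3 / 6 ≤ E ^ 4 := by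
    have h := Real.pow_div_factorial_le_exp (a * n) (by positivity) 3
    rw [hE, ← Real.exp_nat_mul]
    convert h using 2
    · norm_num [Nat.factorial]
    · push_cast
      ring
  have hmn : (m : ℝ) ≤ n + 1 := by nlinarith
  have hpow : 2 * (2 : ℝ) ^ (n * n + n) * 2 ^ m ≤ Real.exp (n * n + 2 * n + 2) := by
    calc 2 * (2 : ℝ) ^ (n * n + n) * 2 ^ m = 2 ^ (1 + (n * n + n) + m) := by
          ring
      _ ≤ Real.exp 1 ^ (1 + (n * n + n) + m) := by
          gcongr
          linarith [Real.add_one_le_exp 1]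
      _ ≤ _ := by
          rw [← Real.exp_nat_mul]
          gcongr
          push_cast
          linarith
  rw [hε, hN]
  calc _ ≤ Real.exp (n * n + 2 * n + 2) * Real.exp (-(E ^ 4 / 16)) := by gcongr
    _ < 1 := by
      rw [← Real.exp_add, Real.exp_lt_one_iff]
      have h5 : (480 : ℝ) * n ^ 2 < a ^ 3 * n * n ^ 2 := by gcongr
      nlinarith

end

/-- for every `δ ∈ (0,1]` there are constants `c₁, c₂ > 0` and `n₀` such
that for every `n ≥ n₀` there exist `m ≥ c₁·n`, a `(δn, ε)`-almost perfect affine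
extractor `AExt : 𝔽₂^n → 𝔽₂^m` with `ε ≤ 2^{-c₂ n}`, and an efficiently samplable
randomized inverter `Inv` with `AExt(Inv(s,r)) = s` always and `Inv(U_m, U_R)` being
`ε`-close to uniform on `𝔽₂^n`. -/
theorem stmt_10 (δ : ℝ) (hδ0 : 0 < δ) (hδ1 : δ ≤ 1) :
    ∃ c₁ c₂ : ℝ, 0 < c₁ ∧ 0 < c₂ ∧ ∃ n₀ : ℕ, ∀ n : ℕ, n₀ ≤ n →
      ∃ (m : ℕ) (AExt : (Fin n → ZMod 2) → Fin m → ZMod 2) (ε : ℝ)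
        (R : Type) (_ : Fintype R) (_ : Nonempty R)
        (Inv : (Fin m → ZMod 2) × R → Fin n → ZMod 2),
        c₁ * (n : ℝ) ≤ (m : ℝ) ∧
        ε ≤ (2 : ℝ) ^ (-(c₂ * (n : ℝ))) ∧
        IsAlmostPerfectAffineExtractor AExt (δ * (n : ℝ)) ε ∧
        (∀ (s : Fin m → ZMod 2) (r : R), AExt (Inv (s, r)) = s) ∧
        SD Inv (id : (Fin n → ZMod 2) → (Fin n → ZMod 2)) ≤ ε := by
  obtain ⟨n₀, hn₀, hbound⟩ := exists_forall_union_bound_lt_one δ hδ0 hδ1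
  refine ⟨δ / 8, δ / 8, by positivity, by positivity, n₀, fun n hn => ?_⟩
  have hn0 : (0 : ℝ) < n := by exact_mod_cast hn₀.trans_le hn
  have hε1 : (2 : ℝ) ^ (-(δ / 8 * n)) < 1 :=
    Real.rpow_lt_one_of_one_lt_of_neg one_lt_two (by
      have : 0 < δ / 8 * n := by positivity
      linarith)
  have hε0 : (0 : ℝ) ≤ (2 : ℝ) ^ (-(δ / 8 * n)) := by positivity
  obtain ⟨A, hA⟩ := exists_isAlmostPerfectAffineExtractor n ⌈δ / 8 * n⌉₊ (δ * n) _ hε0 hε1.le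
    (hbound n hn)
  have hcard : (Nat.card (Fin ⌈δ / 8 * n⌉₊ → ZMod 2) : ℝ) = 2 ^ ⌈δ / 8 * n⌉₊ := by
    simp [Nat.card_eq_fintype_card, ZMod.card]
  have hprob : ∀ y, prob A y =
      prob (fun x : (⊤ : Submodule (ZMod 2) (Fin n → ZMod 2)) =>
        A (0 + (x : Fin n → ZMod 2))) y := fun y => by
    let e := (Submodule.topEquiv (R := ZMod 2) (M := Fin n → ZMod 2)).toEquiv
    rw [prob, prob, Nat.card_congr e]
    congr 2
    exact (Nat.card_congr (e.subtypeEquiv fun x => by rw [zero_add]; rfl)).symm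
  obtain ⟨R, hR, hR', Inv, hInv, hSD⟩ := exists_randomized_inverse A _ hε0 hε1 fun y => by
    rw [hcard, hprob]
    refine hA ⊤ 0 ?_ y
    rw [finrank_top, Module.finrank_fin_fun]
    exact mul_le_of_le_one_left hn0.le hδ1
  exact ⟨⌈δ / 8 * n⌉₊, A, _, R, hR, hR', Inv, Nat.le_ceil _, le_rfl, hA, hInv, hSD⟩
end

section
/- For every 0 ≤ τ < ρ ≤ 1 there exists a constant c > 0 such that for every sufficiently large N ∈ ℕ there is an adaptive (ε(N), δ(N))-secret sharing scheme with N players, secret length ℓ(N) ≥ c·N, privacy threshold t(N) = ⌊τN⌋ and reconstruction threshold r(N) = ⌈ρN⌉, where ε(·) and δ(·) are negligible functions. -/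
/-- `f : ℕ → ℝ` is negligible: for every `k > 0`, `|f N| < N⁻ᵏ` for all large `N`. -/
def Negligible (f : ℕ → ℝ) : Prop :=
  ∀ k : ℕ, 0 < k → ∃ N₀ : ℕ, ∀ N : ℕ, N₀ ≤ N → |f N| < ((N : ℝ) ^ k)⁻¹

/-- The transcript (view) of a deterministic adaptive adversary reading `q` coordinates
of `v : 𝔽₂^N`: the `i`-th index read is a function `Adv i` of the `i` bits observed so
far; the view records the `q` observed bits in order. -/
def advView {N q : ℕ} (Adv : (i : Fin q) → (Fin i.val → ZMod 2) → Fin N)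
    (v : Fin N → ZMod 2) : Fin q → ZMod 2
  | i => v (Adv i (fun j => advView Adv v ⟨j.val, j.isLt.trans i.isLt⟩))
termination_by i => i.val
decreasing_by exact j.isLt

/-- An `(ε,δ)`-secret sharing scheme with `N` players, secret length `ℓ`, privacy
threshold `t` and reconstruction threshold `r`, with adaptive privacy: any `r` shares
determine the secret with probability `≥ 1 - δ`, and the views of any deterministic
adaptive adversary reading at most `t` coordinates on two secrets are `ε`-close. -/
def IsAdaptiveSSS (N ℓ t r : ℕ) (ε δ : ℝ) : Prop :=
  ∃ (R : Type) (_ : Fintype R) (_ : Nonempty R)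
    (Share : (Fin ℓ → ZMod 2) → R → Fin N → ZMod 2)
    (Recst : (Fin N → Option (ZMod 2)) → Option (Fin ℓ → ZMod 2)),
    (∀ (s : Fin ℓ → ZMod 2) (B : Finset (Fin N)), r ≤ B.card →
      1 - δ ≤ prob (fun rc : R =>
        Recst (fun i => if i ∈ B then some (Share s rc i) else none)) (some s)) ∧
    (∀ (q : ℕ), q ≤ t → ∀ (Adv : (i : Fin q) → (Fin i.val → ZMod 2) → Fin N)
        (s₀ s₁ : Fin ℓ → ZMod 2),
      SD (fun rc : R => advView Adv (Share s₀ rc))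
         (fun rc : R => advView Adv (Share s₁ rc)) ≤ ε)

open Finset in
/-- Chernoff bound for the uniform distribution on functions `Fin M → V`. -/
theorem card_le_sum_comp_le_exp {V : Type*} [Fintype V] {M : ℕ} (g : V → ℝ)
    (hg : ∀ x, |g x| ≤ 1) (hsum : ∑ x, g x = 0) {p : ℝ}
    (hsq : ∑ x, g x ^ 2 ≤ p * Fintype.card V) {lam : ℝ} (hlam : 0 ≤ lam) (hlam' : lam ≤ 1)
    (k : ℝ) :
    (Nat.card {f : Fin M → V // k ≤ ∑ i, g (f i)} : ℝ) ≤
      (Fintype.card V : ℝ) ^ M * Real.exp (M * (lam ^ 2 * p) - lam * k) := by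
  classical
  have hmgf : ∑ x, Real.exp (lam * g x) ≤ Fintype.card V * Real.exp (lam ^ 2 * p) := by
    calc ∑ x, Real.exp (lam * g x) ≤ ∑ x, (1 + lam * g x + lam ^ 2 * g x ^ 2) := by
          refine sum_le_sum fun x _ => ?_
          have hx : |lam * g x| ≤ 1 := by
            rw [abs_mul, abs_of_nonneg hlam]
            exact mul_le_one₀ hlam' (abs_nonneg _) (hg x)
          have := (abs_le.mp (Real.abs_exp_sub_one_sub_id_le hx)).2
          nlinarith
      _ = Fintype.card V + lam ^ 2 * ∑ x, g x ^ 2 := by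
          simp [sum_add_distrib, ← mul_sum, hsum]
      _ ≤ Fintype.card V * (lam ^ 2 * p + 1) := by
          nlinarith [mul_le_mul_of_nonneg_left hsq (sq_nonneg lam)]
      _ ≤ _ := by
          gcongr
          exact Real.add_one_le_exp _
  calc (Nat.card {f : Fin M → V // k ≤ ∑ i, g (f i)} : ℝ)
      = ∑ f : Fin M → V, if k ≤ ∑ i, g (f i) then (1 : ℝ) else 0 := by
        rw [Nat.card_eq_fintype_card, Fintype.card_subtype]
        simp
    _ ≤ ∑ f : Fin M → V, Real.exp (-(lam * k)) * ∏ i, Real.exp (lam * g (f i)) := by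
        refine sum_le_sum fun f _ => ?_
        rw [← Real.exp_sum, ← Real.exp_add, ← mul_sum]
        split_ifs with h
        · exact Real.one_le_exp (by nlinarith)
        · positivity
    _ = Real.exp (-(lam * k)) * (∑ x, Real.exp (lam * g x)) ^ M := by
        rw [Fintype.sum_pow, mul_sum]
    _ ≤ Real.exp (-(lam * k)) * (Fintype.card V * Real.exp (lam ^ 2 * p)) ^ M := by
        gcongr
    _ = _ := by
        rw [mul_pow, ← Real.exp_nat_mul, mul_left_comm, ← Real.exp_add, neg_add_eq_sub]

open Classical in
/-- The centred indicator function of `A`. -/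
noncomputable def centredIndicator {V : Type*} [Fintype V] (A : Finset V) (x : V) : ℝ :=
  (if x ∈ A then 1 else 0) - (A.card : ℝ) / Fintype.card V

section centredIndicator

variable {V : Type*} [Fintype V] (A : Finset V)

theorem abs_centredIndicator_le (x : V) : |centredIndicator A x| ≤ 1 := by
  have h0 : (0 : ℝ) ≤ (A.card : ℝ) / Fintype.card V := by positivity
  have h1 : (A.card : ℝ) / Fintype.card V ≤ 1 :=
    div_le_one_of_le₀ (by exact_mod_cast A.card_le_univ) (by positivity)
  unfold centredIndicator
  split_ifs <;> rw [abs_le] <;> constructor <;> linarith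

theorem sum_centredIndicator_comp {M : ℕ} (f : Fin M → V) :
    ∑ i, centredIndicator A (f i) =
      (Nat.card {i // f i ∈ A} : ℝ) - M * ((A.card : ℝ) / Fintype.card V) := by
  classical
  rw [Nat.card_eq_fintype_card, Fintype.card_subtype]
  simp [centredIndicator, Finset.sum_sub_distrib]

variable [Nonempty V]

theorem sum_centredIndicator : ∑ x, centredIndicator A x = 0 := by
  classical
  have : (Fintype.card V : ℝ) ≠ 0 := by positivity
  simp [centredIndicator, Finset.sum_sub_distrib, mul_div_cancel₀ _ this]

theorem sum_centredIndicator_sq_le :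
    ∑ x, centredIndicator A x ^ 2 ≤ (A.card : ℝ) / Fintype.card V * Fintype.card V := by
  classical
  have hV : (Fintype.card V : ℝ) ≠ 0 := by positivity
  have key : ∀ x, centredIndicator A x ^ 2 =
      (if x ∈ A then (1 : ℝ) else 0) - ((A.card : ℝ) / Fintype.card V) ^ 2
        - 2 * ((A.card : ℝ) / Fintype.card V) * centredIndicator A x := by
    intro x
    unfold centredIndicator
    split_ifs <;> ring
  simp_rw [key]
  rw [Finset.sum_sub_distrib, ← Finset.mul_sum, sum_centredIndicator, Finset.sum_sub_distrib]
  simp only [Finset.sum_ite_mem, Finset.univ_inter, Finset.sum_const, Finset.card_univ,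
    nsmul_eq_mul, mul_one, mul_zero, sub_zero]
  rw [div_mul_cancel₀ _ hV]
  have : 0 ≤ (Fintype.card V : ℝ) * ((A.card : ℝ) / Fintype.card V) ^ 2 := by positivity
  linarith

theorem card_upper_tail_le {M : ℕ} {lam : ℝ} (hlam : 0 ≤ lam) (hlam' : lam ≤ 1) (k : ℝ) :
    (Nat.card {f : Fin M → V //
        M * ((A.card : ℝ) / Fintype.card V) + k ≤ Nat.card {i // f i ∈ A}} : ℝ) ≤
      (Fintype.card V : ℝ) ^ M *
        Real.exp (M * (lam ^ 2 * ((A.card : ℝ) / Fintype.card V)) - lam * k) := by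
  have := card_le_sum_comp_le_exp (M := M) (centredIndicator A) (abs_centredIndicator_le A)
    (sum_centredIndicator A) (sum_centredIndicator_sq_le A) hlam hlam' k
  simpa only [sum_centredIndicator_comp, le_sub_iff_add_le'] using this

theorem card_lower_tail_le {M : ℕ} {lam : ℝ} (hlam : 0 ≤ lam) (hlam' : lam ≤ 1) (k : ℝ) :
    (Nat.card {f : Fin M → V //
        (Nat.card {i // f i ∈ A} : ℝ) + k ≤ M * ((A.card : ℝ) / Fintype.card V)} : ℝ) ≤
      (Fintype.card V : ℝ) ^ M *
        Real.exp (M * (lam ^ 2 * ((A.card : ℝ) / Fintype.card V)) - lam * k) := by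
  have := card_le_sum_comp_le_exp (M := M) (fun x => -centredIndicator A x)
    (fun x => by rw [abs_neg]; exact abs_centredIndicator_le A x)
    (by rw [Finset.sum_neg_distrib, sum_centredIndicator, neg_zero])
    (by simpa only [neg_sq] using sum_centredIndicator_sq_le A) hlam hlam' k
  simpa only [Finset.sum_neg_distrib, sum_centredIndicator_comp, neg_sub,
    le_sub_iff_add_le'] using this

end centredIndicator

/-- A property that is rare when only the `s`-th coordinate is resampled is rare. -/
theorem card_le_of_card_update_le {S W : Type*} [Fintype S] [DecidableEq S] [Fintype W]
    [Nonempty W] (s : S) (P : (S → W) → Prop) (c : ℝ)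
    (h : ∀ F, (Nat.card {f : W // P (Function.update F s f)} : ℝ) ≤ c * Fintype.card W) :
    (Nat.card {F // P F} : ℝ) ≤ c * Fintype.card (S → W) := by
  classical
  let e : {x : (S → W) × W // P x.1} ≃ Σ F : S → W, {f : W // P (Function.update F s f)} :=
    { toFun := fun x => ⟨Function.update x.1.1 s x.1.2, x.1.1 s, by simpa using x.2⟩
      invFun := fun y => ⟨(Function.update y.1 s y.2.1, y.1 s), y.2.2⟩
      left_inv := fun x => by simp
      right_inv := fun y => by
        rcases y with ⟨F, f, hf⟩
        refine Sigma.ext (by simp) ?_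
        simp only
        rw [Subtype.heq_iff_coe_eq] <;> simp }
  have h₁ : Nat.card {x : (S → W) × W // P x.1} = Nat.card {F // P F} * Fintype.card W := by
    rw [← Nat.card_eq_fintype_card, ← Nat.card_prod]
    exact Nat.card_congr
      { toFun := fun x => (⟨x.1.1, x.2⟩, x.1.2)
        invFun := fun y => ⟨(y.1.1, y.2), y.1.2⟩
        left_inv := fun _ => rfl
        right_inv := fun _ => rfl }
  have h₂ : (Nat.card {F // P F} : ℝ) * Fintype.card W =
      ∑ F : S → W, (Nat.card {f : W // P (Function.update F s f)} : ℝ) := by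
    rw [← Nat.cast_mul, ← h₁, Nat.card_congr e, Nat.card_sigma, Nat.cast_sum]
  have h₃ : (Nat.card {F // P F} : ℝ) * Fintype.card W ≤
      c * Fintype.card (S → W) * Fintype.card W := by
    rw [h₂]
    refine (Finset.sum_le_sum fun F _ => h F).trans_eq ?_
    simp only [Finset.sum_const, Finset.card_univ, nsmul_eq_mul]
    ring
  exact le_of_mul_le_mul_right h₃ (by positivity)

/-- The union bound. -/
theorem exists_forall_not_of_card_le {J Ω : Type*} [Fintype J] [Fintype Ω] [Nonempty Ω]
    (P : J → Ω → Prop) (c : ℝ) (h : ∀ j, (Nat.card {ω // P j ω} : ℝ) ≤ c * Fintype.card Ω)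
    (hc : Fintype.card J * c < 1) : ∃ ω, ∀ j, ¬ P j ω := by
  classical
  by_contra! hcon
  have h₁ : (Fintype.card Ω : ℝ) ≤ ∑ j, (Nat.card {ω // P j ω} : ℝ) := by
    simp_rw [Nat.card_eq_fintype_card, Fintype.card_subtype]
    rw [← Finset.card_univ]
    have : (Finset.univ : Finset Ω) ⊆ Finset.univ.biUnion fun j => Finset.univ.filter (P j) :=
      fun ω _ => by simpa using hcon ω
    exact_mod_cast (Finset.card_le_card this).trans Finset.card_biUnion_le
  have h₂ : (Fintype.card Ω : ℝ) ≤ Fintype.card J * c * Fintype.card Ω := by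
    refine h₁.trans ((Finset.sum_le_sum fun j _ => h j).trans_eq ?_)
    simp [mul_assoc]
  have : (0 : ℝ) < Fintype.card Ω := by positivity
  nlinarith

theorem natCard_subtype_or_le {Ω : Type*} [Finite Ω] (P Q : Ω → Prop) :
    Nat.card {ω // P ω ∨ Q ω} ≤ Nat.card {ω // P ω} + Nat.card {ω // Q ω} :=
  Set.ncard_union_le {ω | P ω} {ω | Q ω}

/-- The subcube of all binary vectors that agree with `w` on `Q`. -/
def subcube {N : ℕ} (Q : Finset (Fin N)) (w : Fin N → ZMod 2) : Finset (Fin N → ZMod 2) :=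
  Finset.univ.filter fun v => ∀ i ∈ Q, v i = w i

theorem mem_subcube {N : ℕ} {Q : Finset (Fin N)} {w v : Fin N → ZMod 2} :
    v ∈ subcube Q w ↔ ∀ i ∈ Q, v i = w i := by
  simp [subcube]

theorem card_subcube {N : ℕ} (Q : Finset (Fin N)) (w : Fin N → ZMod 2) :
    ((subcube Q w).card : ℝ) / Fintype.card (Fin N → ZMod 2) = ((2 : ℝ) ^ Q.card)⁻¹ := by
  have h : subcube Q w = Fintype.piFinset fun i => if i ∈ Q then {w i} else Finset.univ := by
    ext v
    simp only [mem_subcube, Fintype.mem_piFinset]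
    refine forall_congr' fun i => ?_
    split_ifs with hi <;> simp [hi]
  have h' : (subcube Q w).card * 2 ^ Q.card = 2 ^ N := by
    have hc : ∀ i, (if i ∈ Q then {w i} else Finset.univ : Finset (ZMod 2)).card =
        if i ∈ Q then 1 else 2 := by
      intro i
      split_ifs <;> simp [ZMod.card]
    rw [h, Fintype.card_piFinset]
    simp_rw [hc]
    have h2 : (2 : ℕ) ^ Q.card = ∏ i, if i ∈ Q then 2 else 1 := by simp
    rw [h2, ← Finset.prod_mul_distrib]
    have : ∀ i, ((if i ∈ Q then 1 else 2) * if i ∈ Q then 2 else 1) = 2 := by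
      intro i
      split_ifs <;> rfl
    simp [this]
  rw [div_eq_iff (by positivity), eq_comm, inv_mul_eq_iff_eq_mul₀ (by positivity)]
  simp only [Fintype.card_fun, ZMod.card, Fintype.card_fin]
  exact_mod_cast h'.symm.trans (mul_comm _ _)

theorem advView_eq_iff {N q : ℕ} (Adv : (i : Fin q) → (Fin i.val → ZMod 2) → Fin N)
    (v : Fin N → ZMod 2) (a : Fin q → ZMod 2) :
    advView Adv v = a ↔
      ∀ i : Fin q, v (Adv i fun j => a ⟨j.val, j.isLt.trans i.isLt⟩) = a i := by
  constructor
  · rintro rfl i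
    rw [advView]
  · intro h
    have key : ∀ n (hn : n < q), advView Adv v ⟨n, hn⟩ = a ⟨n, hn⟩ := by
      intro n
      induction n using Nat.strong_induction_on with
      | _ n ih =>
        intro hn
        rw [advView, ← h ⟨n, hn⟩]
        congr 2
        funext j
        exact ih j.val j.isLt (j.isLt.trans hn)
    exact funext fun i => key i.val i.isLt

/-- The vectors that lead to a fixed transcript form a subcube or the empty set. -/
theorem exists_subcube_of_advView {N q : ℕ}
    (Adv : (i : Fin q) → (Fin i.val → ZMod 2) → Fin N) (a : Fin q → ZMod 2) :
    (∀ v, advView Adv v ≠ a) ∨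
      ∃ Q w, Q.card ≤ q ∧ ∀ v, advView Adv v = a ↔ v ∈ subcube Q w := by
  by_cases h : ∃ w, advView Adv w = a
  · obtain ⟨w, hw⟩ := h
    right
    refine ⟨Finset.univ.image fun i : Fin q =>
      Adv i fun j => a ⟨j.val, j.isLt.trans i.isLt⟩, w, ?_, fun v => ?_⟩
    · exact Finset.card_image_le.trans (by simp)
    · rw [advView_eq_iff] at hw
      simp [advView_eq_iff, mem_subcube, hw]
  · left
    simpa using h

theorem sum_prob {Ω α : Type*} [Finite Ω] [Nonempty Ω] [Fintype α] (X : Ω → α) :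
    ∑ a, prob X a = 1 := by
  have h : ∑ a, Nat.card {ω // X ω = a} = Nat.card Ω := by
    rw [← Nat.card_sigma]
    exact Nat.card_congr (Equiv.sigmaFiberEquiv X)
  have h0 : (Nat.card Ω : ℝ) ≠ 0 := by exact_mod_cast Nat.card_pos.ne'
  simp only [prob, ← Finset.sum_div]
  rw [← Nat.cast_sum, h, div_self h0]

/-- If every subcube of codimension at most `t` has nearly the right frequency in both samples,
no adaptive adversary reading `t` coordinates tells the samples apart. -/
theorem SD_advView_le {N t M : ℕ} {ε : ℝ} (hM : 0 < M) (f₀ f₁ : Fin M → Fin N → ZMod 2)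
    (h₀ : ∀ (Q : Finset (Fin N)) (w : Fin N → ZMod 2), Q.card ≤ t →
      |(Nat.card {i // f₀ i ∈ subcube Q w} : ℝ) - M * ((2 : ℝ) ^ Q.card)⁻¹| ≤
        ε * (M * ((2 : ℝ) ^ Q.card)⁻¹))
    (h₁ : ∀ (Q : Finset (Fin N)) (w : Fin N → ZMod 2), Q.card ≤ t →
      |(Nat.card {i // f₁ i ∈ subcube Q w} : ℝ) - M * ((2 : ℝ) ^ Q.card)⁻¹| ≤
        ε * (M * ((2 : ℝ) ^ Q.card)⁻¹))
    {q : ℕ} (hq : q ≤ t) (Adv : (i : Fin q) → (Fin i.val → ZMod 2) → Fin N) :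
    SD (fun i => advView Adv (f₀ i)) (fun i => advView Adv (f₁ i)) ≤ ε := by
  have hM' : (0 : ℝ) < M := by exact_mod_cast hM
  have key : ∀ f : Fin M → Fin N → ZMod 2,
      (∀ (Q : Finset (Fin N)) (w : Fin N → ZMod 2), Q.card ≤ t →
        |(Nat.card {i // f i ∈ subcube Q w} : ℝ) - M * ((2 : ℝ) ^ Q.card)⁻¹| ≤
          ε * (M * ((2 : ℝ) ^ Q.card)⁻¹)) →
      ∀ a, |prob (fun i => advView Adv (f i)) a - prob (advView Adv) a| ≤
        ε * prob (advView Adv) a := by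
    intro f hf a
    rcases exists_subcube_of_advView Adv a with h | ⟨Q, w, hQ, h⟩
    · simp [prob, h]
    · have hu : prob (advView Adv) a = ((2 : ℝ) ^ Q.card)⁻¹ := by
        rw [← card_subcube Q w]
        simp [prob, h]
      have hf' := hf Q w (hQ.trans hq)
      simp only [prob, h] at hu ⊢
      rw [hu]
      rw [Nat.card_fin, ← mul_le_mul_iff_of_pos_right hM', ← abs_of_pos hM', ← abs_mul,
        abs_of_pos hM', sub_mul, div_mul_cancel₀ _ hM'.ne']
      rw [mul_comm _ (M : ℝ), mul_assoc ε, mul_comm _ (M : ℝ)]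
      exact hf'
  calc SD (fun i => advView Adv (f₀ i)) (fun i => advView Adv (f₁ i))
      ≤ 1 / 2 * ∑ a, 2 * ε * prob (advView Adv) a := by
        unfold SD
        gcongr with a
        have e₀ := key f₀ h₀ a
        have e₁ := key f₁ h₁ a
        rw [abs_le] at e₀ e₁ ⊢
        constructor <;> linarith
    _ = ε := by
        rw [← Finset.mul_sum, sum_prob]
        ring

/-- The codewords of secrets other than `s` cover, on the coordinates `B`, few vectors. -/
theorem exists_finset_confusable {N ℓ M : ℕ} (F : (Fin ℓ → ZMod 2) → Fin M → Fin N → ZMod 2)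
    (s : Fin ℓ → ZMod 2) (B : Finset (Fin N)) :
    ∃ A : Finset (Fin N → ZMod 2),
      (∀ v, v ∈ A ↔ ∃ s', s' ≠ s ∧ ∃ j, ∀ i ∈ B, v i = F s' j i) ∧
      (A.card : ℝ) / Fintype.card (Fin N → ZMod 2) ≤ 2 ^ ℓ * M * ((2 : ℝ) ^ B.card)⁻¹ := by
  classical
  refine ⟨(Finset.univ.filter (· ≠ s)).biUnion fun s' =>
    Finset.univ.biUnion fun j => subcube B (F s' j), fun v => by simp [mem_subcube], ?_⟩
  have h : (((Finset.univ.filter (· ≠ s)).biUnion fun s' =>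
      Finset.univ.biUnion fun j => subcube B (F s' j)).card : ℝ) ≤
      ∑ s' : Fin ℓ → ZMod 2, ∑ j, ((subcube B (F s' j)).card : ℝ) := by
    calc _ ≤ ∑ s' ∈ Finset.univ.filter (· ≠ s), ∑ j, ((subcube B (F s' j)).card : ℝ) := by
          exact_mod_cast Finset.card_biUnion_le.trans
            (Finset.sum_le_sum fun s' _ => Finset.card_biUnion_le)
      _ ≤ _ := Finset.sum_le_sum_of_subset_of_nonneg (Finset.filter_subset _ _)
          fun _ _ _ => by positivity
  refine (div_le_div_of_nonneg_right h (by positivity)).trans_eq ?_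
  simp_rw [Finset.sum_div, card_subcube]
  simp [mul_assoc]

open Classical in
/-- Decode an erased word to a secret one of whose codewords is consistent with it. -/
noncomputable def consistentDecoder {N ℓ M : ℕ}
    (F : (Fin ℓ → ZMod 2) → Fin M → Fin N → ZMod 2) (y : Fin N → Option (ZMod 2)) :
    Option (Fin ℓ → ZMod 2) :=
  if h : ∃ s, ∃ j, ∀ i b, y i = some b → F s j i = b then some h.choose else none

theorem consistentDecoder_eq {N ℓ M : ℕ} (F : (Fin ℓ → ZMod 2) → Fin M → Fin N → ZMod 2)
    (s : Fin ℓ → ZMod 2) (j : Fin M) (B : Finset (Fin N))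
    (h : ¬ ∃ s', s' ≠ s ∧ ∃ j', ∀ i ∈ B, F s j i = F s' j' i) :
    consistentDecoder F (fun i => if i ∈ B then some (F s j i) else none) = some s := by
  have hex : ∃ s', ∃ j', ∀ i b, (if i ∈ B then some (F s j i) else none) = some b →
      F s' j' i = b := by
    refine ⟨s, j, fun i b hb => ?_⟩
    split_ifs at hb
    exact Option.some.inj hb
  rw [consistentDecoder, dif_pos hex]
  by_contra hne
  obtain ⟨j', hj'⟩ := hex.choose_spec
  refine h ⟨hex.choose, fun e => hne (congrArg some e), j', fun i hi => ?_⟩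
  exact (hj' i _ (by rw [if_pos hi])).symm

/-- A code with few confusable codewords reconstructs the secret from the shares in `B`. -/
theorem one_sub_le_prob_consistentDecoder {N ℓ M : ℕ} {δ : ℝ} (hM : 0 < M)
    (F : (Fin ℓ → ZMod 2) → Fin M → Fin N → ZMod 2) (s : Fin ℓ → ZMod 2) (B : Finset (Fin N))
    (h : (Nat.card {j // ∃ s', s' ≠ s ∧ ∃ j', ∀ i ∈ B, F s j i = F s' j' i} : ℝ) ≤ δ * M) :
    1 - δ ≤ prob (fun j =>
      consistentDecoder F (fun i => if i ∈ B then some (F s j i) else none)) (some s) := by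
  have hM' : (0 : ℝ) < M := by exact_mod_cast hM
  rw [prob, Nat.card_fin, le_div_iff₀ hM']
  have hcover : (M : ℝ) ≤
      (Nat.card {j // ∃ s', s' ≠ s ∧ ∃ j', ∀ i ∈ B, F s j i = F s' j' i} : ℝ) +
      (Nat.card {j // consistentDecoder F
        (fun i => if i ∈ B then some (F s j i) else none) = some s} : ℝ) := by
    have := natCard_subtype_or_le
      (fun j => ∃ s', s' ≠ s ∧ ∃ j', ∀ i ∈ B, F s j i = F s' j' i)
      (fun j => consistentDecoder F
        (fun i => if i ∈ B then some (F s j i) else none) = some s)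
    rw [Nat.card_congr (Equiv.subtypeUnivEquiv fun j => ?_), Nat.card_fin] at this
    · exact_mod_cast this
    · exact or_iff_not_imp_left.mpr (consistentDecoder_eq F s j B)
  linarith

/-- A random code is an adaptive secret sharing scheme. -/
theorem isAdaptiveSSS_of_union_bound {N t r n : ℕ} (hr : t + 8 * n ≤ r)
    (hN : 2 ^ n * 2 ^ N * 2 ^ N * (3 * Real.exp (-(4 ^ n / 4))) < 1) :
    IsAdaptiveSSS N n t r ((2 : ℝ) ^ n)⁻¹ (3 * ((2 : ℝ) ^ n)⁻¹) := by
  set M : ℕ := 2 ^ (t + 4 * n) with hMdef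
  have hM : 0 < M := by positivity
  have : Nonempty (Fin M) := ⟨⟨0, hM⟩⟩
  set ε : ℝ := ((2 : ℝ) ^ n)⁻¹ with hε
  have hε0 : 0 < ε := by positivity
  have hε1 : ε ≤ 1 := inv_le_one_of_one_le₀ (one_le_pow₀ (by norm_num))
  have hMR : (M : ℝ) = 2 ^ t * (2 ^ n) ^ 4 := by
    rw [hMdef]; push_cast; rw [← pow_mul, ← pow_add, mul_comm n 4]
  have h4 : (4 : ℝ) ^ n = (2 ^ n) ^ 2 := by rw [← pow_mul, mul_comm, pow_mul]; norm_num
  let P : (Fin n → ZMod 2) × Finset (Fin N) × (Fin N → ZMod 2) →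
      ((Fin n → ZMod 2) → Fin M → Fin N → ZMod 2) → Prop := fun x F =>
    ((x.2.1.card ≤ t ∧ M * ((2 : ℝ) ^ x.2.1.card)⁻¹ + ε * (M * ((2 : ℝ) ^ x.2.1.card)⁻¹) ≤
        Nat.card {j // F x.1 j ∈ subcube x.2.1 x.2.2}) ∨
      (x.2.1.card ≤ t ∧ Nat.card {j // F x.1 j ∈ subcube x.2.1 x.2.2} +
        ε * (M * ((2 : ℝ) ^ x.2.1.card)⁻¹) ≤ M * ((2 : ℝ) ^ x.2.1.card)⁻¹)) ∨
      (r ≤ x.2.1.card ∧ 3 * ε * M ≤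
        Nat.card {j // ∃ s', s' ≠ x.1 ∧ ∃ j', ∀ i ∈ x.2.1, F x.1 j i = F s' j' i})
  have hexp : ∀ Q : Finset (Fin N), Q.card ≤ t →
      Real.exp (M * ((ε / 2) ^ 2 * ((2 : ℝ) ^ Q.card)⁻¹) -
        ε / 2 * (ε * (M * ((2 : ℝ) ^ Q.card)⁻¹))) ≤ Real.exp (-(4 ^ n / 4)) := by
    intro Q hQ
    rw [Real.exp_le_exp]
    have h1 : (1 : ℝ) ≤ 2 ^ t * ((2 : ℝ) ^ Q.card)⁻¹ := by
      rw [← div_eq_mul_inv, one_le_div (by positivity)]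
      exact pow_le_pow_right₀ (by norm_num) hQ
    have h2 : ε ^ 2 * M = 2 ^ t * 4 ^ n := by
      rw [hMR, hε, h4]; field_simp
    have h3 : M * ((ε / 2) ^ 2 * ((2 : ℝ) ^ Q.card)⁻¹) -
        ε / 2 * (ε * (M * ((2 : ℝ) ^ Q.card)⁻¹)) =
        -((ε ^ 2 * M) * ((2 : ℝ) ^ Q.card)⁻¹ / 4) := by ring
    rw [h3, h2]
    have : (4 : ℝ) ^ n * 1 ≤ 4 ^ n * (2 ^ t * ((2 : ℝ) ^ Q.card)⁻¹) := by gcongr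
    linarith
  have hbad : ∀ x, (Nat.card {F // P x F} : ℝ) ≤ 3 * Real.exp (-(4 ^ n / 4)) *
      Fintype.card ((Fin n → ZMod 2) → Fin M → Fin N → ZMod 2) := by
    rintro ⟨s, Q, w⟩
    refine card_le_of_card_update_le s (P (s, Q, w)) _ fun F => ?_
    have hW : (Fintype.card (Fin M → Fin N → ZMod 2) : ℝ) =
        (Fintype.card (Fin N → ZMod 2) : ℝ) ^ M := by
      rw [Fintype.card_fun (α := Fin M), Fintype.card_fin]
      push_cast
      rfl
    have hupper : (Nat.card {f : Fin M → Fin N → ZMod 2 // Q.card ≤ t ∧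
        M * ((2 : ℝ) ^ Q.card)⁻¹ + ε * (M * ((2 : ℝ) ^ Q.card)⁻¹) ≤
          Nat.card {j // f j ∈ subcube Q w}} : ℝ) ≤
        Real.exp (-(4 ^ n / 4)) * Fintype.card (Fin M → Fin N → ZMod 2) := by
      by_cases hQ : Q.card ≤ t
      · have := card_upper_tail_le (subcube Q w) (M := M) (lam := ε / 2) (by linarith)
          (by linarith) (ε * (M * ((2 : ℝ) ^ Q.card)⁻¹))
        rw [card_subcube, ← hW] at this
        simp only [hQ, true_and]
        refine this.trans ?_
        rw [mul_comm]
        gcongr ?_ * _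
        exact hexp Q hQ
      · simp only [hQ, false_and, Nat.card_of_isEmpty, Nat.cast_zero]
        positivity
    have hlower : (Nat.card {f : Fin M → Fin N → ZMod 2 // Q.card ≤ t ∧
        Nat.card {j // f j ∈ subcube Q w} + ε * (M * ((2 : ℝ) ^ Q.card)⁻¹) ≤
          M * ((2 : ℝ) ^ Q.card)⁻¹} : ℝ) ≤
        Real.exp (-(4 ^ n / 4)) * Fintype.card (Fin M → Fin N → ZMod 2) := by
      by_cases hQ : Q.card ≤ t
      · have := card_lower_tail_le (subcube Q w) (M := M) (lam := ε / 2) (by linarith)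
          (by linarith) (ε * (M * ((2 : ℝ) ^ Q.card)⁻¹))
        rw [card_subcube, ← hW] at this
        simp only [hQ, true_and]
        refine this.trans ?_
        rw [mul_comm]
        gcongr ?_ * _
        exact hexp Q hQ
      · simp only [hQ, false_and, Nat.card_of_isEmpty, Nat.cast_zero]
        positivity
    obtain ⟨A, hA, hAcard⟩ := exists_finset_confusable F s Q
    have hrecst : (Nat.card {f : Fin M → Fin N → ZMod 2 // r ≤ Q.card ∧
        3 * ε * M ≤ Nat.card {j // f j ∈ A}} : ℝ) ≤
        Real.exp (-(4 ^ n / 4)) * Fintype.card (Fin M → Fin N → ZMod 2) := by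
      by_cases hQ : r ≤ Q.card
      · set p : ℝ := (A.card : ℝ) / Fintype.card (Fin N → ZMod 2) with hp
        have hpε : p ≤ ε := by
          refine hAcard.trans ?_
          have h8 : (2 : ℝ) ^ t * (2 ^ n) ^ 8 ≤ 2 ^ Q.card := by
            rw [← pow_mul, ← pow_add]
            exact pow_le_pow_right₀ (by norm_num) (by omega)
          have h1 : (1 : ℝ) ≤ 2 ^ n := one_le_pow₀ (by norm_num)
          rw [hMR, hε, ← div_eq_mul_inv, div_le_iff₀ (by positivity),
            ← div_eq_inv_mul, le_div_iff₀ (by positivity)]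
          refine le_trans ?_ h8
          have : ((2 : ℝ) ^ n) ^ 6 ≤ (2 ^ n) ^ 8 := pow_le_pow_right₀ h1 (by norm_num)
          calc (2 : ℝ) ^ n * (2 ^ t * (2 ^ n) ^ 4) * 2 ^ n = 2 ^ t * (2 ^ n) ^ 6 := by ring
            _ ≤ _ := by gcongr
        have := card_upper_tail_le A (M := M) (lam := 1) zero_le_one le_rfl
          (3 * ε * M - M * p)
        rw [← hp, add_sub_cancel, ← hW] at this
        simp only [hQ, true_and]
        refine this.trans ?_
        rw [mul_comm]
        gcongr ?_ * _
        rw [Real.exp_le_exp]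
        have h1 : (1 : ℝ) ≤ 2 ^ n := one_le_pow₀ (by norm_num)
        have h2 : (1 : ℝ) ≤ 2 ^ t := one_le_pow₀ (by norm_num)
        have hεM : (4 : ℝ) ^ n ≤ ε * M := by
          have h3 : ε * M = 2 ^ t * (2 ^ n) ^ 3 := by rw [hMR, hε]; field_simp
          rw [h3, h4]
          calc ((2 : ℝ) ^ n) ^ 2 ≤ (2 ^ n) ^ 3 := pow_le_pow_right₀ h1 (by norm_num)
            _ ≤ _ := le_mul_of_one_le_left (by positivity) h2
        have hMp : M * p ≤ ε * M := by
          rw [mul_comm]; gcongr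
        have h5 : (0 : ℝ) < 4 ^ n := by positivity
        nlinarith
      · simp only [hQ, false_and, Nat.card_of_isEmpty, Nat.cast_zero]
        positivity
    have hPeq : ∀ f, P (s, Q, w) (Function.update F s f) ↔
        ((Q.card ≤ t ∧ M * ((2 : ℝ) ^ Q.card)⁻¹ + ε * (M * ((2 : ℝ) ^ Q.card)⁻¹) ≤
          Nat.card {j // f j ∈ subcube Q w}) ∨
        (Q.card ≤ t ∧ Nat.card {j // f j ∈ subcube Q w} +
          ε * (M * ((2 : ℝ) ^ Q.card)⁻¹) ≤ M * ((2 : ℝ) ^ Q.card)⁻¹)) ∨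
        (r ≤ Q.card ∧ 3 * ε * M ≤ Nat.card {j // f j ∈ A}) := by
      intro f
      have hupd : ∀ j, (∃ s', s' ≠ s ∧ ∃ j', ∀ i ∈ Q,
          f j i = Function.update F s f s' j' i) ↔ f j ∈ A := by
        intro j
        rw [hA]
        refine exists_congr fun s' => and_congr_right fun hs' => ?_
        rw [Function.update_of_ne hs']
      simp only [P, Function.update_self, hupd]
    simp only [hPeq]
    have hu₁ := natCard_subtype_or_le
      (fun f : Fin M → Fin N → ZMod 2 => (Q.card ≤ t ∧
          M * ((2 : ℝ) ^ Q.card)⁻¹ + ε * (M * ((2 : ℝ) ^ Q.card)⁻¹) ≤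
          Nat.card {j // f j ∈ subcube Q w}) ∨
        (Q.card ≤ t ∧ Nat.card {j // f j ∈ subcube Q w} +
          ε * (M * ((2 : ℝ) ^ Q.card)⁻¹) ≤ M * ((2 : ℝ) ^ Q.card)⁻¹))
      (fun f => r ≤ Q.card ∧ 3 * ε * M ≤ Nat.card {j // f j ∈ A})
    have hu₂ := natCard_subtype_or_le
      (fun f : Fin M → Fin N → ZMod 2 => Q.card ≤ t ∧
          M * ((2 : ℝ) ^ Q.card)⁻¹ + ε * (M * ((2 : ℝ) ^ Q.card)⁻¹) ≤
          Nat.card {j // f j ∈ subcube Q w})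
      (fun f => Q.card ≤ t ∧ Nat.card {j // f j ∈ subcube Q w} +
          ε * (M * ((2 : ℝ) ^ Q.card)⁻¹) ≤ M * ((2 : ℝ) ^ Q.card)⁻¹)
    have hu := hu₁.trans (Nat.add_le_add_right hu₂ _)
    rw [← Nat.cast_le (α := ℝ)] at hu
    push_cast at hu
    linarith
  obtain ⟨F, hF⟩ := exists_forall_not_of_card_le P _ hbad (by
    simpa [Fintype.card_prod, ZMod.card, mul_assoc] using hN)
  have hpriv : ∀ s (Q : Finset (Fin N)) (w : Fin N → ZMod 2), Q.card ≤ t →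
      |(Nat.card {j // F s j ∈ subcube Q w} : ℝ) - M * ((2 : ℝ) ^ Q.card)⁻¹| ≤
        ε * (M * ((2 : ℝ) ^ Q.card)⁻¹) := by
    intro s Q w hQ
    have h := hF (s, Q, w)
    simp only [P, hQ, true_and, not_or, not_le] at h
    rw [abs_le]
    constructor <;> linarith [h.1.1, h.1.2]
  refine ⟨Fin M, inferInstance, inferInstance, F, consistentDecoder F, fun s B hB => ?_,
    fun q hq Adv s₀ s₁ => SD_advView_le hM _ _ (hpriv s₀) (hpriv s₁) hq Adv⟩
  refine one_sub_le_prob_consistentDecoder hM F s B ?_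
  have h := hF (s, B, 0)
  simp only [P, hB, true_and, not_or, not_le] at h
  exact h.2.le

open Filter Topology in
theorem negligible_const_mul_inv_two_pow_floor {η : ℝ} (hη : 0 < η) (C : ℝ) :
    Negligible fun N => C * ((2 : ℝ) ^ ⌊η * N⌋₊)⁻¹ := by
  intro k _
  have hb : 0 < η * Real.log 2 := mul_pos hη (Real.log_pos (by norm_num))
  have ht := ((tendsto_rpow_mul_exp_neg_mul_atTop_nhds_zero (k : ℝ) _ hb).comp
    tendsto_natCast_atTop_atTop).const_mul (2 * (|C| + 1))
  rw [mul_zero] at ht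
  obtain ⟨N₀, hN₀⟩ := eventually_atTop.mp
    ((ht.eventually_lt_const one_pos).and (eventually_gt_atTop 0))
  refine ⟨N₀, fun N hN => ?_⟩
  obtain ⟨h, hpos⟩ := hN₀ N hN
  simp only [Function.comp, Real.rpow_natCast] at h
  have hN' : (0 : ℝ) < N := by exact_mod_cast hpos
  have hfl : ((2 : ℝ) ^ ⌊η * N⌋₊)⁻¹ ≤ 2 * Real.exp (-(η * Real.log 2) * N) := by
    have h1 : η * N < ⌊η * N⌋₊ + 1 := Nat.lt_floor_add_one _
    have h2 : (2 : ℝ) ^ ⌊η * N⌋₊ = Real.exp (Real.log 2 * ⌊η * N⌋₊) := by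
      rw [mul_comm (Real.log 2), Real.exp_nat_mul, Real.exp_log two_pos]
    rw [h2, ← Real.exp_neg]
    calc _ ≤ Real.exp (Real.log 2 + -(η * Real.log 2) * N) := by
          rw [Real.exp_le_exp]
          nlinarith [Real.log_pos (show (1 : ℝ) < 2 by norm_num)]
      _ = _ := by rw [Real.exp_add, Real.exp_log two_pos]
  rw [abs_mul, abs_of_pos (by positivity : (0 : ℝ) < ((2 : ℝ) ^ ⌊η * N⌋₊)⁻¹),
    ← one_div ((N : ℝ) ^ k), lt_div_iff₀ (by positivity)]
  refine lt_of_le_of_lt ?_ h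
  calc |C| * ((2 : ℝ) ^ ⌊η * N⌋₊)⁻¹ * (N : ℝ) ^ k
      ≤ (|C| + 1) * (2 * Real.exp (-(η * Real.log 2) * N)) * (N : ℝ) ^ k := by
        gcongr
        linarith
    _ = _ := by ring

open Filter in
theorem eventually_union_bound {η : ℝ} (hη : 0 < η) (hη' : η ≤ 1) :
    ∀ᶠ N : ℕ in atTop, (2 : ℝ) ^ ⌊η * N⌋₊ * 2 ^ N * 2 ^ N *
      (3 * Real.exp (-(4 ^ ⌊η * N⌋₊ / 4))) < 1 := by
  obtain ⟨N₀, hN₀⟩ := negligible_const_mul_inv_two_pow_floor hη 20 2 two_pos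
  filter_upwards [eventually_ge_atTop N₀, eventually_ge_atTop 1] with N hN hN1
  have h := hN₀ N hN
  beta_reduce at h
  set n := ⌊η * (N : ℝ)⌋₊
  have hnN : n ≤ N := Nat.floor_le_of_le (mul_le_of_le_one_left (by positivity) hη')
  have hN1' : (1 : ℝ) ≤ N := by exact_mod_cast hN1
  rw [abs_of_pos (by positivity), ← div_eq_mul_inv, ← one_div ((N : ℝ) ^ 2),
    div_lt_div_iff₀ (by positivity) (by positivity), one_mul] at h
  have h24 : (2 : ℝ) ^ n ≤ 4 ^ n := by gcongr; norm_num
  have htwo : (2 : ℝ) ≤ Real.exp 1 := by linarith [Real.add_one_le_exp (1 : ℝ)]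
  have hthree : (3 : ℝ) ≤ Real.exp 2 := by linarith [Real.add_one_le_exp (2 : ℝ)]
  have hpow : (2 : ℝ) ^ N ≤ Real.exp N := by
    rw [← mul_one (N : ℝ), Real.exp_nat_mul]
    gcongr
  have hpow' : (2 : ℝ) ^ n ≤ Real.exp N :=
    (pow_le_pow_right₀ (by norm_num) hnN).trans hpow
  calc (2 : ℝ) ^ n * 2 ^ N * 2 ^ N * (3 * Real.exp (-(4 ^ n / 4)))
      ≤ Real.exp N * Real.exp N * Real.exp N * (Real.exp 2 * Real.exp (-(4 ^ n / 4))) := by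
        gcongr
    _ = Real.exp (N + N + N + (2 + -(4 ^ n / 4))) := by simp only [Real.exp_add]
    _ < 1 := by
        rw [Real.exp_lt_one_iff]
        nlinarith

/-- for every `0 ≤ τ < ρ ≤ 1` there is a constant `c > 0` such that for
all sufficiently large `N` there is an adaptive `(ε(N), δ(N))`-secret sharing scheme
with `N` players, secret length `ℓ(N) ≥ c·N`, privacy threshold `⌊τN⌋` and
reconstruction threshold `⌈ρN⌉`, with `ε, δ` negligible. -/
theorem stmt_14 (τ ρ : ℝ) (hτ : 0 ≤ τ) (hτρ : τ < ρ) (hρ : ρ ≤ 1) :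
    ∃ c : ℝ, 0 < c ∧ ∃ (ℓ : ℕ → ℕ) (ε δ : ℕ → ℝ),
      Negligible ε ∧ Negligible δ ∧
      ∃ N₀ : ℕ, ∀ N : ℕ, N₀ ≤ N →
        c * (N : ℝ) ≤ (ℓ N : ℝ) ∧
        IsAdaptiveSSS N (ℓ N) ⌊τ * (N : ℝ)⌋₊ ⌈ρ * (N : ℝ)⌉₊ (ε N) (δ N) := by
  set η : ℝ := (ρ - τ) / 8 with hηdef
  have hη : 0 < η := by rw [hηdef]; linarith
  have hη' : η ≤ 1 := by rw [hηdef]; linarith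
  obtain ⟨N₁, hN₁⟩ := Filter.eventually_atTop.mp (eventually_union_bound hη hη')
  refine ⟨η / 2, by positivity, fun N => ⌊η * N⌋₊, fun N => ((2 : ℝ) ^ ⌊η * N⌋₊)⁻¹,
    fun N => 3 * ((2 : ℝ) ^ ⌊η * N⌋₊)⁻¹, ?_,
    negligible_const_mul_inv_two_pow_floor hη 3, max N₁ ⌈2 / η⌉₊, fun N hN => ⟨?_, ?_⟩⟩
  · simpa using negligible_const_mul_inv_two_pow_floor hη 1
  · have h1 : 2 / η ≤ N := (Nat.le_ceil _).trans (by exact_mod_cast (le_max_right _ _).trans hN)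
    rw [div_le_iff₀ hη] at h1
    have h2 : η * N < ⌊η * N⌋₊ + 1 := Nat.lt_floor_add_one _
    linarith
  · refine isAdaptiveSSS_of_union_bound ?_ (hN₁ N ((le_max_left _ _).trans hN))
    have h1 : (⌊τ * N⌋₊ : ℝ) ≤ τ * N := Nat.floor_le (by positivity)
    have h2 : ρ * N ≤ ⌈ρ * N⌉₊ := Nat.le_ceil _
    have h3 : (⌊η * N⌋₊ : ℝ) ≤ η * N := Nat.floor_le (by positivity)
    have h4 : (8 : ℝ) * (η * N) = ρ * N - τ * N := by rw [hηdef]; ring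
    have : (⌊τ * N⌋₊ : ℝ) + 8 * ⌊η * N⌋₊ ≤ ⌈ρ * N⌉₊ := by linarith
    exact_mod_cast this
end
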